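/- Let G ≤ Sym(Ω) be a semiprimitive permutation group with plinth K such that the commutator subgroup [K,K] is a proper subgroup of K. Then K is regular and the centraliser C_G(K) of K in G is contained in K. -/

import Mathlib

open Pointwise

def IsTransitiveOn {G : Type*} [Group G] (N : Subgroup G) (Ω : Type*) [MulAction G Ω] : Prop :=
  ∀ a b : Ω, ∃ n ∈ N, n • a = b

def IsSemiregularOn {G : Type*} [Group G] (N : Subgroup G) (Ω : Type*) [MulAction G Ω] : Prop :=
  ∀ n ∈ N, (∃ a : Ω, n • a = a) → n = 1

def IsSemiprimitive (G Ω : Type*) [Group G] [MulAction G Ω] : Prop :=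
  IsTransitiveOn (⊤ : Subgroup G) Ω ∧
    ∀ N : Subgroup G, N.Normal → IsTransitiveOn N Ω ∨ IsSemiregularOn N Ω

def IsPlinth {G : Type*} [Group G] (K : Subgroup G) (Ω : Type*) [MulAction G Ω] : Prop :=
  K.Normal ∧ IsTransitiveOn K Ω ∧
    ∀ N : Subgroup G, N.Normal → N < K → ¬ IsTransitiveOn N Ω

/-- The elements of `G` that fix setwise every orbit of the subgroup `D`. -/
def orbitKernel {G : Type*} [Group G] (D : Subgroup G) (Ω : Type*) [MulAction G Ω] :
    Subgroup G where
  carrier := {g | ∀ a : Ω, ∃ d ∈ D, g • a = d • a}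
  one_mem' a := ⟨1, D.one_mem, rfl⟩
  mul_mem' := by
    intro g h hg hh a
    obtain ⟨d, hd, hda⟩ := hh a
    obtain ⟨e, he, hea⟩ := hg (d • a)
    exact ⟨e * d, D.mul_mem he hd, by rw [mul_smul, hda, hea, mul_smul]⟩
  inv_mem' := by
    intro g hg a
    obtain ⟨d, hd, hda⟩ := hg (g⁻¹ • a)
    rw [smul_inv_smul] at hda
    exact ⟨d⁻¹, D.inv_mem hd, eq_inv_smul_iff.mpr hda.symm⟩

theorem orbitKernel_normal {G Ω : Type*} [Group G] [MulAction G Ω] (D : Subgroup G)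
    [hD : D.Normal] : (orbitKernel D Ω).Normal where
  conj_mem n hn g a := by
    obtain ⟨d, hd, hda⟩ := hn (g⁻¹ • a)
    exact ⟨g * d * g⁻¹, hD.conj_mem d hd g, by simp only [mul_smul, hda]⟩

theorem IsTransitiveOn.of_orbitKernel {G Ω : Type*} [Group G] [MulAction G Ω] {D : Subgroup G}
    (h : IsTransitiveOn (orbitKernel D Ω) Ω) : IsTransitiveOn D Ω := by
  intro a b
  obtain ⟨n, hn, rfl⟩ := h a b
  obtain ⟨d, hd, hda⟩ := hn a
  exact ⟨d, hd, hda.symm⟩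

/-- If `K` is transitive, any element of `K * C_G(K)` with a fixed point fixes setwise every
orbit of `[K, K]`. -/
theorem mul_mem_orbitKernel_commutator {G Ω : Type*} [Group G] [MulAction G Ω] {K : Subgroup G}
    (hK : IsTransitiveOn K Ω) {k c : G} (hk : k ∈ K)
    (hc : c ∈ Subgroup.centralizer (K : Set G)) {a : Ω} (ha : (k * c) • a = a) :
    k * c ∈ orbitKernel ⁅K, K⁆ Ω := by
  intro b
  obtain ⟨x, hx, rfl⟩ := hK a b
  refine ⟨k * x * k⁻¹ * x⁻¹, Subgroup.commutator_mem_commutator hk hx, ?_⟩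
  have hxc : x * c = c * x := Subgroup.mem_centralizer_iff.mp hc x hx
  have hca : c • a = k⁻¹ • a := by rwa [eq_inv_smul_iff, ← mul_smul]
  calc (k * c) • x • a = (k * x) • c • a := by
        simp only [← mul_smul, mul_assoc, hxc]
    _ = (k * x * k⁻¹ * x⁻¹) • x • a := by
        rw [hca]
        simp only [← mul_smul, mul_assoc, inv_mul_cancel, mul_one]

/-- Let `G ≤ Sym(Ω)` be semiprimitive with plinth `K` such that `[K,K] < K`.  Then `K` is
regular and `C_G(K) ≤ K`. -/
theorem stmt8 {G Ω : Type*} [Group G] [MulAction G Ω] [FaithfulSMul G Ω]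
    (hG : IsSemiprimitive G Ω) (K : Subgroup G) (hK : IsPlinth K Ω)
    (hnonperf : ⁅K, K⁆ < K) :
    (IsTransitiveOn K Ω ∧ IsSemiregularOn K Ω) ∧
      Subgroup.centralizer (K : Set G) ≤ K := by
  obtain ⟨hKn, hKt, hKmin⟩ := hK
  have hN : IsSemiregularOn (orbitKernel ⁅K, K⁆ Ω) Ω :=
    (hG.2 _ (orbitKernel_normal _)).resolve_left fun h =>
      hKmin _ inferInstance hnonperf h.of_orbitKernel
  have eq_one : ∀ k ∈ K, ∀ c ∈ Subgroup.centralizer (K : Set G), ∀ a : Ω,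
      (k * c) • a = a → k * c = 1 := fun k hk c hc a ha =>
    hN _ (mul_mem_orbitKernel_commutator hKt hk hc ha) ⟨a, ha⟩
  refine ⟨⟨hKt, ?_⟩, ?_⟩
  · rintro k hk ⟨a, ha⟩
    simpa using eq_one k hk 1 (Subgroup.one_mem _) a (by simpa using ha)
  · intro c hc
    rcases isEmpty_or_nonempty Ω with hΩ | ⟨⟨a⟩⟩
    · have hc1 : c = 1 := FaithfulSMul.eq_of_smul_eq_smul (α := Ω) fun a => hΩ.elim a
      exact hc1 ▸ K.one_mem
    · obtain ⟨k, hk, hka⟩ := hKt (c • a) a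
      have hkc := eq_one k hk c hc a (by rwa [mul_smul])
      exact eq_inv_of_mul_eq_one_right hkc ▸ K.inv_mem hk
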